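/- arXiv:2603.20013 — 2 statements merged into one kernel-verified Lean document; each statement's English description precedes it below -/
import Mathlib

section
/- Let F be a real m×n matrix with full column rank (rank F = n) and let P be a symmetric positive definite real m×m matrix. Define the BLUE gain K := (Fᵀ P⁻¹ F)⁻¹ Fᵀ P⁻¹. Then for every real n×m matrix L satisfying L F = Iₙ (i.e., every linear unbiased estimator gain), the matrix L P Lᵀ − K P Kᵀ is positive semidefinite; that is, the BLUE gain minimizes the error covariance L P Lᵀ in the Loewner order over all linear unbiased gains. -/
open Matrix

/-- The BLUE gain `K := (Fᵀ P⁻¹ F)⁻¹ Fᵀ P⁻¹` minimizes the error covariance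
`L P Lᵀ` in the Loewner order over all linear unbiased gains `L` (i.e. those with `L F = 1`). -/
theorem blue_gain_optimal
    {m n : ℕ} (F : Matrix (Fin m) (Fin n) ℝ) (P : Matrix (Fin m) (Fin m) ℝ)
    (hF : F.rank = n) (hP : P.PosDef)
    (K : Matrix (Fin n) (Fin m) ℝ)
    (hK : K = (Fᵀ * P⁻¹ * F)⁻¹ * Fᵀ * P⁻¹) :
    ∀ L : Matrix (Fin n) (Fin m) ℝ, L * F = 1 →
      (L * P * Lᵀ - K * P * Kᵀ).PosSemidef := by
  intro L hL
  have hinj : Function.Injective F.mulVec := fun x y hxy => by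
    simpa [mulVec_mulVec, hL] using congrArg (L *ᵥ ·) hxy
  set S := Fᵀ * P⁻¹ * F with hSdef
  have hS : S.PosDef := by
    simpa [conjTranspose_eq_transpose_of_trivial] using
      hP.inv.conjTranspose_mul_mul_same hinj
  have hST : Sᵀ = S := hS.isHermitian
  have hPT : Pᵀ = P := hP.isHermitian
  have hPu : IsUnit P.det := (isUnit_iff_isUnit_det P).mp hP.isUnit
  have hSu : IsUnit S.det := (isUnit_iff_isUnit_det S).mp hS.isUnit
  have hKP : K * P = S⁻¹ * Fᵀ := by
    rw [hK, Matrix.mul_assoc, nonsing_inv_mul P hPu, Matrix.mul_one]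
  have hKF : K * F = 1 := by
    rw [hK, Matrix.mul_assoc, Matrix.mul_assoc, ← Matrix.mul_assoc Fᵀ, ← hSdef,
      nonsing_inv_mul S hSu]
  have key : ∀ M : Matrix (Fin n) (Fin m) ℝ, M * F = 1 → K * P * Mᵀ = S⁻¹ := fun M hM => by
    rw [hKP, Matrix.mul_assoc, ← transpose_mul, hM, transpose_one, Matrix.mul_one]
  have hLK : L * P * Kᵀ = S⁻¹ := by
    simpa [transpose_mul, transpose_nonsing_inv, hST, hPT, Matrix.mul_assoc] using
      congrArg transpose (key L hL)
  have hdiff : L * P * Lᵀ - K * P * Kᵀ = (L - K) * P * (L - K)ᵀ := by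
    rw [transpose_sub, Matrix.sub_mul, Matrix.sub_mul, Matrix.mul_sub, Matrix.mul_sub,
      hLK, key L hL, key K hKF]
    abel
  rw [hdiff]
  simpa [conjTranspose_eq_transpose_of_trivial] using
    hP.posSemidef.mul_mul_conjTranspose_same (L - K)
end

section
/- Let A ∈ ℝ^{n×n}, C ∈ ℝ^{m×n}, let R ∈ ℝ^{m×m} be invertible, let Ω̃ ∈ ℝ^{n×n}, and suppose Ω := Ω̃ + Cᵀ R⁻¹ C is invertible. Let σ : Fin d → Fin N be injective with selection matrix η and blocks Γ_k, set 𝟏 := 𝟏_d ⊗ Iₙ, and suppose S̄ ∈ ℝ^{dn×dn} is invertible with Ω̃ = 𝟏ᵀ S̄⁻¹ 𝟏. Define the fixed observer gains D_k := A Ω⁻¹ 𝟏ᵀ S̄⁻¹ Γ_k for k ∈ Fin d and F' := A Ω⁻¹ Cᵀ R⁻¹. Then Σ_{k ∈ Fin d} D_k + F' C = A (consistency of the fixed-gain distributed observer). -/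
open Matrix
open scoped Kronecker

/-- Consistency of the fixed-gain distributed observer: with
`Ω := Ω̃ + Cᵀ R⁻¹ C` invertible, `Ω̃ = 𝟏ᵀ S̄⁻¹ 𝟏`, fixed gains
`D_k := A Ω⁻¹ 𝟏ᵀ S̄⁻¹ Γ_k` and `F' := A Ω⁻¹ Cᵀ R⁻¹`, one has `Σ_k D_k + F' C = A`. -/
theorem fixed_gain_observer_consistency
    {n m d N : ℕ} (hd : 1 ≤ d) (hn : 1 ≤ n)
    (A : Matrix (Fin n) (Fin n) ℝ) (C : Matrix (Fin m) (Fin n) ℝ)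
    (R : Matrix (Fin m) (Fin m) ℝ) (hR : IsUnit R.det)
    (Ωt : Matrix (Fin n) (Fin n) ℝ)
    (Ω : Matrix (Fin n) (Fin n) ℝ) (hΩdef : Ω = Ωt + Cᵀ * R⁻¹ * C)
    (hΩ : IsUnit Ω.det)
    (σ : Fin d → Fin N) (hσ : Function.Injective σ)
    (E : Matrix (Fin d) (Fin N) ℝ)
    (hE : ∀ k j, E k j = if j = σ k then 1 else 0)
    (η : Matrix (Fin d × Fin n) (Fin N × Fin n) ℝ)
    (hη : η = E ⊗ₖ (1 : Matrix (Fin n) (Fin n) ℝ))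
    (e : Fin N → Matrix (Fin N) (Fin 1) ℝ)
    (he : ∀ j i l, e j i l = if i = j then 1 else 0)
    (Γ : Fin d → Matrix (Fin d × Fin n) (Fin n) ℝ)
    (hΓ : ∀ k, Γ k =
      (η * (e (σ k) ⊗ₖ (1 : Matrix (Fin n) (Fin n) ℝ))).submatrix id
        (fun j => ((0 : Fin 1), j)))
    (onesd : Matrix (Fin d) (Fin 1) ℝ) (honesd : ∀ k l, onesd k l = 1)
    (ones : Matrix (Fin d × Fin n) (Fin n) ℝ)
    (hones : ones =
      (onesd ⊗ₖ (1 : Matrix (Fin n) (Fin n) ℝ)).submatrix id (fun j => ((0 : Fin 1), j)))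
    (Sbar : Matrix (Fin d × Fin n) (Fin d × Fin n) ℝ) (hSbar : IsUnit Sbar.det)
    (hΩt : Ωt = onesᵀ * Sbar⁻¹ * ones)
    (D : Fin d → Matrix (Fin n) (Fin n) ℝ)
    (hD : ∀ k, D k = A * Ω⁻¹ * (onesᵀ * Sbar⁻¹ * Γ k))
    (F' : Matrix (Fin n) (Fin m) ℝ)
    (hF' : F' = A * Ω⁻¹ * Cᵀ * R⁻¹) :
    ∑ k, D k + F' * C = A := by
  have hEe (k i : Fin d) : (E * e (σ k)) i 0 = if k = i then 1 else 0 := by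
    simp [Matrix.mul_apply, hE, he, hσ.eq_iff]
  have hsum : ∑ k, Γ k = ones := by
    ext ⟨i, a⟩ b
    simp only [hΓ, hη, hones, ← Matrix.mul_kronecker_mul, Matrix.mul_one, Matrix.sum_apply,
      Matrix.submatrix_apply, id, Matrix.kroneckerMap_apply, hEe, honesd, ← Finset.sum_mul]
    simp
  simp only [hD]
  rw [← Matrix.mul_sum, ← Matrix.mul_sum, hsum, ← hΩt, hF', Matrix.mul_assoc (A * Ω⁻¹),
    Matrix.mul_assoc (A * Ω⁻¹), ← Matrix.mul_add, ← hΩdef, Matrix.mul_assoc,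
    Matrix.nonsing_inv_mul _ hΩ, Matrix.mul_one]
end
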